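/- (Half-flux equals Dirichlet problem) For every p > 2 and α > -1/4, μ_{1/2,p}(α) = ν_p(α), where μ_{1/2,p}(α) is the optimal constant in the magnetic interpolation inequality with flux a = 1/2 and ν_p(α) is the infimum over nonzero v ∈ H¹₀(S¹) of (‖v'‖²_{L²} + α‖v‖²_{L²})/‖v‖²_{L^p}. -/

import Mathlib

open Real MeasureTheory

/-- The magnetic interpolation quotient on the circle, with magnetic flux `a`,
exponent `p` and parameter `α`. Norms with respect to the uniform probability
measure `ds/(2π)` on `(-π, π]`. -/
noncomputable def magQuot (a p α : ℝ) (ψ : ℝ → ℂ) : ℝ :=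
  ((1 / (2 * π)) * (∫ s in (-π)..π, ‖deriv ψ s + Complex.I * (a : ℂ) * ψ s‖ ^ 2)
    + α * ((1 / (2 * π)) * ∫ s in (-π)..π, ‖ψ s‖ ^ 2))
  / ((1 / (2 * π)) * ∫ s in (-π)..π, ‖ψ s‖ ^ p) ^ (2 / p)

/-- Admissible class: nonzero continuous `2π`-periodic functions with
`ψ' + iaψ ∈ L²(S¹)`. -/
def magAdm (a : ℝ) : Set (ℝ → ℂ) :=
  {ψ | Continuous ψ ∧ Function.Periodic ψ (2 * π) ∧ Differentiable ℝ ψ ∧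
    IntervalIntegrable (fun s => ‖deriv ψ s + Complex.I * (a : ℂ) * ψ s‖ ^ 2)
      volume (-π) π ∧ ψ ≠ 0}

/-- The optimal constant `μ_{a,p}(α)` in the magnetic interpolation inequality. -/
noncomputable def muMag (a p α : ℝ) : ℝ := sInf (magQuot a p α '' magAdm a)


/-- The Dirichlet quotient on `(-π, π)`. -/
noncomputable def dirQuot (p α : ℝ) (v : ℝ → ℂ) : ℝ :=
  ((1 / (2 * π)) * (∫ s in (-π)..π, ‖deriv v s‖ ^ 2)
    + α * ((1 / (2 * π)) * ∫ s in (-π)..π, ‖v s‖ ^ 2))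
  / ((1 / (2 * π)) * ∫ s in (-π)..π, ‖v s‖ ^ p) ^ (2 / p)

/-- Admissible class for the Dirichlet problem: `H¹` functions on `(-π, π]`
vanishing at `±π`, not identically zero. -/
def dirAdm : Set (ℝ → ℂ) :=
  {v | Continuous v ∧ Differentiable ℝ v ∧
    IntervalIntegrable (fun s => ‖deriv v s‖ ^ 2) volume (-π) π ∧
    v (-π) = 0 ∧ v π = 0 ∧ ∃ s ∈ Set.Icc (-π) π, v s ≠ 0}

/-- The Dirichlet optimal constant `ν_p(α)`. -/
noncomputable def nuDir (p α : ℝ) : ℝ := sInf (dirQuot p α '' dirAdm)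


lemma aux_nonneg (p α : ℝ) (hα : -(1 / 4 : ℝ) < α) (v : ℝ → ℂ) (hv : v ∈ dirAdm) :
    0 ≤ dirQuot p α v := by
  obtain ⟨hc, hd, hi, h1, h2, -⟩ := hv
  have hpi := Real.pi_pos
  obtain ⟨c, hc0, hc1, hcα⟩ : ∃ c : ℝ, 0 ≤ c ∧ c < 1/2 ∧ -α ≤ c^2 := by
    by_cases h : 0 ≤ α
    · exact ⟨0, le_rfl, by norm_num, by simpa using h⟩
    · push Not at h
      refine ⟨√(-α), Real.sqrt_nonneg _, ?_, ?_⟩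
      · rw [Real.sqrt_lt' (by norm_num)]; norm_num at *; linarith
      · rw [Real.sq_sqrt (by linarith)]
  have hcos : ∀ s ∈ Set.uIcc (-π) π, Real.cos (c * s) ≠ 0 := by
    intro s hs
    rw [Set.uIcc_of_le (by linarith)] at hs
    apply ne_of_gt
    apply Real.cos_pos_of_mem_Ioo
    constructor
    · nlinarith [hs.1, hs.2]
    · nlinarith [hs.1, hs.2]
  have hder : ∀ s ∈ Set.uIcc (-π) π, HasDerivAt (fun s => c * Real.tan (c * s) * ‖v s‖^2)
      (c^2 * (1 + Real.tan (c*s)^2) * ‖v s‖^2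
        + c * Real.tan (c * s) * (2 * inner ℝ (v s) (deriv v s))) s := by
    intro s hs
    have e1 : HasDerivAt (fun s => c * s) c s := by simpa using (hasDerivAt_id s).const_mul c
    have e2 := ((Real.hasDerivAt_tan (hcos s hs)).comp s e1).const_mul c
    have e3 := (hd s).hasDerivAt.norm_sq
    refine (e2.mul e3).congr_deriv ?_
    simp only [Function.comp]
    have : 1 / Real.cos (c*s)^2 = 1 + Real.tan (c*s)^2 := by
      rw [Real.tan_eq_sin_div_cos]
      have := hcos s hs
      field_simp
      linarith [Real.sin_sq_add_cos_sq (c*s)]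
    rw [this]; ring
  have htan : ContinuousOn (fun s => Real.tan (c * s)) (Set.uIcc (-π) π) := by
    intro s hs
    have := (Real.continuousAt_tan.2 (hcos s hs))
    exact (ContinuousAt.comp (f := fun s : ℝ => c * s) this (by fun_prop)).continuousWithinAt
  -- L2 integrability
  have hms : AEStronglyMeasurable (deriv v) (volume.restrict (Set.uIoc (-π) π)) :=
    (stronglyMeasurable_deriv v).aestronglyMeasurable
  have hid : IntervalIntegrable (deriv v) volume (-π) π := by
    have h1' : IntervalIntegrable (fun s => 1 + ‖deriv v s‖^2) volume (-π) π :=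
      (intervalIntegrable_const).add hi
    refine h1'.mono_fun hms (Filter.Eventually.of_forall fun s => ?_)
    simp only [Real.norm_eq_abs]
    rw [abs_of_nonneg (by positivity)]
    nlinarith [sq_nonneg (‖deriv v s‖ - 1)]
  have hin : IntervalIntegrable (fun s => (inner ℝ (v s) (deriv v s) : ℝ)) volume (-π) π := by
    have h1' : IntervalIntegrable (fun s => ‖v s‖^2 + ‖deriv v s‖^2) volume (-π) π :=
      ((by fun_prop : Continuous fun s => ‖v s‖^2).intervalIntegrable _ _).add hi
    refine h1'.mono_fun ?_ (Filter.Eventually.of_forall fun s => ?_)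
    · exact hc.aestronglyMeasurable.inner hms
    · refine (norm_inner_le_norm _ _).trans ?_
      simp only [Real.norm_eq_abs]
      rw [abs_of_nonneg (by positivity)]
      nlinarith [sq_nonneg (‖deriv v s‖ - ‖v s‖), sq_nonneg (‖deriv v s‖), sq_nonneg (‖v s‖)]
  have hcv : IntervalIntegrable (fun s => ‖v s‖^2) volume (-π) π :=
    (by fun_prop : Continuous fun s => ‖v s‖^2).intervalIntegrable _ _
  have hG1 : IntervalIntegrable (fun s => c^2 * (1 + Real.tan (c*s)^2) * ‖v s‖^2) volume (-π) π := by
    apply ContinuousOn.intervalIntegrable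
    exact (continuousOn_const.mul (continuousOn_const.add (htan.pow 2))).mul
      (by fun_prop : Continuous fun s => ‖v s‖^2).continuousOn
  have hG2 : IntervalIntegrable (fun s => c * Real.tan (c * s) * (2 * inner ℝ (v s) (deriv v s)))
      volume (-π) π :=
    (hin.const_mul 2).continuousOn_mul (continuousOn_const.mul htan)
  have hFTC := intervalIntegral.integral_eq_sub_of_hasDerivAt hder (hG1.add hG2)
  simp only [h1, h2, norm_zero] at hFTC
  have hmono : ∫ s in (-π)..π, (c^2 * ‖v s‖^2 - (c^2 * (1 + Real.tan (c*s)^2) * ‖v s‖^2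
        + c * Real.tan (c * s) * (2 * inner ℝ (v s) (deriv v s)))) ≤ ∫ s in (-π)..π, ‖deriv v s‖^2 := by
    apply intervalIntegral.integral_mono_on (by linarith) ((hcv.const_mul _).sub (hG1.add hG2)) hi
    intro s hs
    have := norm_add_sq_real ((c * Real.tan (c*s)) • v s) (deriv v s)
    rw [inner_smul_left, norm_smul, mul_pow, Real.norm_eq_abs, sq_abs] at this
    simp only [conj_trivial] at this
    nlinarith [sq_nonneg (‖(c * Real.tan (c*s)) • v s + deriv v s‖)]
  rw [intervalIntegral.integral_sub (hcv.const_mul _) (hG1.add hG2), hFTC,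
    intervalIntegral.integral_const_mul] at hmono
  have hB : 0 ≤ ∫ s in (-π)..π, ‖v s‖^2 :=
    intervalIntegral.integral_nonneg (by linarith) (fun s _ => by positivity)
  have hC : 0 ≤ ∫ s in (-π)..π, ‖v s‖^p :=
    intervalIntegral.integral_nonneg (by linarith) (fun s _ => by positivity)
  unfold dirQuot
  apply div_nonneg
  · have : 0 ≤ (∫ s in (-π)..π, ‖deriv v s‖^2) + α * ∫ s in (-π)..π, ‖v s‖^2 := by
      norm_num at hmono
      nlinarith
    have h3 : 0 ≤ 1 / (2*π) := by positivity
    nlinarith [mul_nonneg h3 this]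
  · apply Real.rpow_nonneg
    positivity

lemma aux_bdd (p α : ℝ) (hα : -(1 / 4 : ℝ) < α) : BddBelow (dirQuot p α '' dirAdm) :=
  ⟨0, by rintro _ ⟨v, hv, rfl⟩; exact aux_nonneg p α hα v hv⟩

lemma aux_nu_nonneg (p α : ℝ) (hα : -(1 / 4 : ℝ) < α) : 0 ≤ nuDir p α :=
  Real.sInf_nonneg (by rintro _ ⟨v, hv, rfl⟩; exact aux_nonneg p α hα v hv)

lemma aux_real (p α : ℝ) (hp : 2 < p) (hα : -(1 / 4 : ℝ) < α) (f : ℝ → ℝ)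
    (hf : Differentiable ℝ f) (ha : ∀ s, f (s + 2 * π) = - f s)
    (hi : IntervalIntegrable (fun s => (deriv f s)^2) volume (-π) π) :
    nuDir p α * ((1 / (2 * π)) * ∫ s in (-π)..π, |f s| ^ p) ^ (2 / p) ≤
      (1 / (2 * π)) * (∫ s in (-π)..π, (deriv f s)^2)
        + α * ((1 / (2 * π)) * ∫ s in (-π)..π, (f s)^2) := by
  have hpi := Real.pi_pos
  by_cases h0 : ∀ s, f s = 0
  · have : f = fun _ => 0 := funext h0
    subst this
    simp [Real.zero_rpow (by linarith : p ≠ 0), Real.zero_rpow (by positivity : 2 / p ≠ 0)]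
  push Not at h0
  obtain ⟨s0, hs0⟩ := h0
  obtain ⟨z, hz⟩ : ∃ z, f z = 0 := by
    rcases le_total 0 (f 0) with h | h
    · exact mem_range_of_exists_le_of_exists_ge hf.continuous ⟨0 + 2*π, by rw [ha]; linarith⟩ ⟨0, h⟩
    · exact mem_range_of_exists_le_of_exists_ge hf.continuous ⟨0, h⟩ ⟨0 + 2*π, by rw [ha]; linarith⟩
  have hda : ∀ s, deriv f (s + 2*π) = - deriv f s := by
    intro s
    have h1 := deriv_comp_add_const f (2*π) s
    rw [← h1, ← deriv.fun_neg]
    congr 1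
    exact funext ha
  -- periodic functions
  have key : ∀ F : ℝ → ℝ, Function.Periodic F (2*π) →
      ∫ s in (-π)..π, F (s + (z + π)) = ∫ s in (-π)..π, F s := by
    intro F hF
    rw [intervalIntegral.integral_comp_add_right]
    have := hF.intervalIntegral_add_eq (-π + (z + π)) (-π)
    convert this using 2 <;> ring
  have p1 : Function.Periodic (fun s => (deriv f s)^2) (2*π) := fun s => by simp [hda]
  have p2 : Function.Periodic (fun s => (f s)^2) (2*π) := fun s => by simp [ha]
  have p3 : Function.Periodic (fun s => |f s|^p) (2*π) := fun s => by simp [ha]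
  have p4 : Function.Periodic (fun s => |f s|) (2*π) := fun s => by simp [ha]
  let w : ℝ → ℂ := fun s => ((f (s + (z+π)) : ℝ) : ℂ)
  have hwd : ∀ s, HasDerivAt w ((deriv f (s + (z+π)) : ℝ) : ℂ) s := by
    intro s
    exact ((hf (s + (z+π))).hasDerivAt.comp_add_const s (z+π)).ofReal_comp
  have hwdd : Differentiable ℝ w := fun s => (hwd s).differentiableAt
  have hwde : ∀ s, ‖deriv w s‖^2 = (deriv f (s + (z+π)))^2 := by
    intro s; rw [(hwd s).deriv, Complex.norm_real, Real.norm_eq_abs, sq_abs]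
  have hw : w ∈ dirAdm := by
    refine ⟨hwdd.continuous, hwdd, ?_, ?_, ?_, ?_⟩
    · simp only [hwde]
      have h1 : IntervalIntegrable (fun s => (deriv f s)^2) volume (-π + (z+π)) (π + (z+π)) :=
        p1.intervalIntegrable (by positivity) (t := -π) (by convert hi using 1; ring) _ _
      have := h1.comp_add_right (z+π)
      simpa using this
    · simp [w, hz]
    · have : w π = (( f (z + 2*π) : ℝ) : ℂ) := by simp only [w]; congr 2; ring
      rw [this, ha, hz]; simp
    · obtain ⟨y, hy, hy2⟩ := p4.exists_mem_Ico (by positivity) s0 z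
      refine ⟨y - (z+π), ⟨by linarith [hy.1], by linarith [hy.2]⟩, ?_⟩
      simp only [w]
      simp only [sub_add_cancel]
      intro h
      have h' : f y = 0 := by exact_mod_cast h
      rw [h'] at hy2
      simp at hy2
      exact hs0 hy2
  have hle : nuDir p α ≤ dirQuot p α w := csInf_le (aux_bdd p α hα) ⟨w, hw, rfl⟩
  have hq : dirQuot p α w = ((1 / (2 * π)) * (∫ s in (-π)..π, (deriv f s)^2)
        + α * ((1 / (2 * π)) * ∫ s in (-π)..π, (f s)^2)) /
        ((1 / (2 * π)) * ∫ s in (-π)..π, |f s| ^ p) ^ (2 / p) := by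
    unfold dirQuot
    simp only [hwde]
    have e2 : ∀ s, ‖w s‖ = |f (s + (z+π))| := fun s => by simp [w]
    simp only [e2, sq_abs]
    rw [key _ p1, key _ p2, key _ p3]
  rw [hq] at hle
  have hpos : 0 < ∫ s in (-π)..π, |f s| ^ p := by
    obtain ⟨y, hy, hy2⟩ := p4.exists_mem_Ico (by positivity) s0 (-π)
    have hcont : Continuous fun s => |f s|^p :=
      hf.continuous.abs.rpow_const (fun s => Or.inr (by linarith))
    apply intervalIntegral.integral_pos (by linarith) hcont.continuousOn (fun s _ => by positivity)
    refine ⟨y, ⟨hy.1, by linarith [hy.2]⟩, ?_⟩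
    rw [← hy2]
    exact Real.rpow_pos_of_pos (abs_pos.2 hs0) _
  rwa [le_div_iff₀ (by positivity)] at hle

lemma aux_mink (q : ℝ) (hq : 1 ≤ q) (f g : ℝ → ℝ) (hf : Continuous f) (hg : Continuous g)
    (hf0 : ∀ s, 0 ≤ f s) (hg0 : ∀ s, 0 ≤ g s) :
    (∫ s in (-π)..π, (f s + g s)^q)^(1/q) ≤ (∫ s in (-π)..π, f s^q)^(1/q)
      + (∫ s in (-π)..π, g s^q)^(1/q) := by
  have hpi := Real.pi_pos
  have hq0 : 0 < q := by linarith
  have key : ∀ h : ℝ → ℝ, Continuous h → (∀ s, 0 ≤ h s) →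
      (∫ s in (-π)..π, h s^q)^(1/q)
        = ((∫⁻ s, (ENNReal.ofReal (h s))^q ∂(volume.restrict (Set.Ioc (-π) π)))^(1/q)).toReal ∧
      (∫⁻ s, (ENNReal.ofReal (h s))^q ∂(volume.restrict (Set.Ioc (-π) π)))^(1/q) ≠ ⊤ := by
    intro h hh h0
    have hcont : Continuous fun s => (h s)^q := hh.rpow_const (fun s => Or.inr (by linarith))
    have hint : IntegrableOn (fun s => (h s)^q) (Set.Ioc (-π) π) :=
      (hcont.intervalIntegrable (-π) π).1
    have := ofReal_integral_eq_lintegral_ofReal hint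
      (Filter.Eventually.of_forall fun s => Real.rpow_nonneg (h0 s) q)
    simp only [← ENNReal.ofReal_rpow_of_nonneg (h0 _) hq0.le] at this
    rw [← this, intervalIntegral.integral_of_le (by linarith)]
    have hn : 0 ≤ ∫ s in Set.Ioc (-π) π, h s^q :=
      integral_nonneg fun s => Real.rpow_nonneg (h0 s) q
    rw [ENNReal.ofReal_rpow_of_nonneg hn (by positivity)]
    exact ⟨(ENNReal.toReal_ofReal (by positivity)).symm, ENNReal.ofReal_ne_top⟩
  obtain ⟨a1, a2⟩ := key f hf hf0
  obtain ⟨b1, b2⟩ := key g hg hg0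
  obtain ⟨c1, c2⟩ := key (fun s => f s + g s) (hf.add hg) (fun s => add_nonneg (hf0 s) (hg0 s))
  rw [a1, b1, c1, ← ENNReal.toReal_add a2 b2]
  apply ENNReal.toReal_mono (ENNReal.add_ne_top.2 ⟨a2, b2⟩)
  have := ENNReal.lintegral_Lp_add_le (μ := volume.restrict (Set.Ioc (-π) π))
    (f := fun s => ENNReal.ofReal (f s)) (g := fun s => ENNReal.ofReal (g s))
    (by fun_prop) (by fun_prop) hq
  refine le_trans (le_of_eq ?_) this
  congr 2
  ext s
  simp only [Pi.add_apply]
  rw [ENNReal.ofReal_add (hf0 s) (hg0 s)]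

lemma aux_exp_deriv (ψ : ℝ → ℂ) (s : ℝ) (k : ℂ) (d : ℂ) (h : HasDerivAt ψ d s) :
    HasDerivAt (fun s : ℝ => Complex.exp (k * (s : ℂ)) * ψ s)
      (Complex.exp (k * (s : ℂ)) * (d + k * ψ s)) s := by
  have e0 : HasDerivAt (fun s : ℝ => k * (s : ℂ)) k s := by
    simpa using (HasDerivAt.ofReal_comp (hasDerivAt_id s)).const_mul k
  have e1 := e0.cexp
  refine (e1.mul h).congr_deriv ?_
  ring

lemma aux_mag (p α : ℝ) (hp : 2 < p) (hα : -(1 / 4 : ℝ) < α) (ψ : ℝ → ℂ)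
    (hψ : ψ ∈ magAdm (1/2)) : nuDir p α ≤ magQuot (1/2) p α ψ := by
  obtain ⟨hc, hper, hd, hi, hne⟩ := hψ
  have hpi := Real.pi_pos
  set k : ℂ := Complex.I * ((1/2 : ℝ) : ℂ) with hk
  let v : ℝ → ℂ := fun s => Complex.exp (k * (s : ℂ)) * ψ s
  have hexp : ∀ s : ℝ, ‖Complex.exp (k * (s : ℂ))‖ = 1 := by
    intro s
    have : k * (s : ℂ) = ((1/2 * s : ℝ) : ℂ) * Complex.I := by rw [hk]; push_cast; ring
    rw [this, Complex.norm_exp_ofReal_mul_I]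
  have hvd : ∀ s : ℝ, HasDerivAt v (Complex.exp (k * (s : ℂ)) * (deriv ψ s + k * ψ s)) s :=
    fun s => aux_exp_deriv ψ s k _ (hd s).hasDerivAt
  have hvdd : Differentiable ℝ v := fun s => (hvd s).differentiableAt
  have hvn : ∀ s, ‖v s‖ = ‖ψ s‖ := fun s => by simp only [v, norm_mul, hexp, one_mul]
  have hvdn : ∀ s, ‖deriv v s‖ = ‖deriv ψ s + k * ψ s‖ := fun s => by
    rw [(hvd s).deriv, norm_mul, hexp, one_mul]
  have hva : ∀ s, v (s + 2*π) = - v s := by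
    intro s
    simp only [v]
    rw [hper s]
    have : k * ((s + 2*π : ℝ) : ℂ) = k * (s : ℂ) + π * Complex.I := by
      rw [hk]; push_cast; ring
    rw [this, Complex.exp_add, Complex.exp_pi_mul_I]; ring
  let f : ℝ → ℝ := fun s => (v s).re
  let g : ℝ → ℝ := fun s => (v s).im
  have hfd : ∀ s, HasDerivAt f (deriv v s).re s := fun s =>
    (Complex.reCLM.hasFDerivAt.comp_hasDerivAt s (hvdd s).hasDerivAt)
  have hgd : ∀ s, HasDerivAt g (deriv v s).im s := fun s =>
    (Complex.imCLM.hasFDerivAt.comp_hasDerivAt s (hvdd s).hasDerivAt)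
  have hfdd : Differentiable ℝ f := fun s => (hfd s).differentiableAt
  have hgdd : Differentiable ℝ g := fun s => (hgd s).differentiableAt
  have hsq : ∀ z : ℂ, ‖z‖^2 = z.re^2 + z.im^2 := fun z => by
    rw [← Complex.normSq_eq_norm_sq, Complex.normSq_apply]; ring
  have hi' : IntervalIntegrable (fun s => ‖deriv v s‖^2) volume (-π) π := by
    simpa only [hvdn] using hi
  have hif : IntervalIntegrable (fun s => (deriv f s)^2) volume (-π) π := by
    refine hi'.mono_fun ((measurable_deriv f).pow_const 2).aestronglyMeasurable
      (Filter.Eventually.of_forall fun s => ?_)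
    simp only [norm_pow, Real.norm_eq_abs, sq_abs]
    rw [(hfd s).deriv, hsq]; nlinarith [sq_nonneg (deriv v s).im]
  have hig : IntervalIntegrable (fun s => (deriv g s)^2) volume (-π) π := by
    refine hi'.mono_fun ((measurable_deriv g).pow_const 2).aestronglyMeasurable
      (Filter.Eventually.of_forall fun s => ?_)
    simp only [norm_pow, Real.norm_eq_abs, sq_abs]
    rw [(hgd s).deriv, hsq]; nlinarith [sq_nonneg (deriv v s).re]
  have Rf := aux_real p α hp hα f hfdd (fun s => by simp [f, hva]) hif
  have Rg := aux_real p α hp hα g hgdd (fun s => by simp [g, hva]) hig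
  have hfc := hfdd.continuous
  have hgc := hgdd.continuous
  have I1 : (∫ s in (-π)..π, ‖deriv ψ s + k * ψ s‖^2)
      = (∫ s in (-π)..π, (deriv f s)^2) + ∫ s in (-π)..π, (deriv g s)^2 := by
    rw [← intervalIntegral.integral_add hif hig]
    congr 1; ext s
    rw [← hvdn, hsq, (hfd s).deriv, (hgd s).deriv]
  have I2 : (∫ s in (-π)..π, ‖ψ s‖^2)
      = (∫ s in (-π)..π, (f s)^2) + ∫ s in (-π)..π, (g s)^2 := by
    rw [← intervalIntegral.integral_add ((by fun_prop : Continuous fun s => f s^2).intervalIntegrable _ _)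
      ((by fun_prop : Continuous fun s => g s^2).intervalIntegrable _ _)]
    congr 1; ext s
    rw [← hvn, hsq]
  have M := aux_mink (p/2) (by linarith) (fun s => f s^2) (fun s => g s^2) (hfc.pow 2) (hgc.pow 2)
    (fun s => sq_nonneg _) (fun s => sq_nonneg _)
  have hpw : ∀ x : ℝ, (x^2)^(p/2) = |x|^p := by
    intro x
    rw [← sq_abs, ← Real.rpow_natCast, ← Real.rpow_mul (abs_nonneg x)]
    congr 1; push_cast; ring
  have hpw' : ∀ s, (f s^2 + g s^2)^(p/2) = ‖ψ s‖^p := by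
    intro s
    rw [← hvn, ← hsq, hpw, abs_of_nonneg (norm_nonneg _)]
  have hpp : 1/(p/2) = 2/p := by field_simp
  simp only [hpw, hpw', hpp] at M
  have hCpos : 0 < ∫ s in (-π)..π, ‖ψ s‖ ^ p := by
    obtain ⟨s0, hs0⟩ : ∃ s, ψ s ≠ 0 := by
      by_contra! h; exact hne (funext h)
    obtain ⟨y, hy, hy2⟩ := hper.exists_mem_Ico (by positivity) s0 (-π)
    have hcont : Continuous fun s => ‖ψ s‖^p :=
      hc.norm.rpow_const (fun s => Or.inr (by linarith))
    apply intervalIntegral.integral_pos (by linarith) hcont.continuousOn (fun s _ => by positivity)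
    refine ⟨y, ⟨hy.1, by linarith [hy.2]⟩, ?_⟩
    rw [← hy2]
    exact Real.rpow_pos_of_pos (norm_pos_iff.2 hs0) _
  have hnn : ∀ h : ℝ → ℝ, 0 ≤ ∫ s in (-π)..π, |h s|^p := fun h =>
    intervalIntegral.integral_nonneg (by linarith) (fun s _ => by positivity)
  have hnu := aux_nu_nonneg p α hα
  unfold magQuot
  rw [← hk, le_div_iff₀ (by positivity), I1, I2]
  have hc0 : (0:ℝ) ≤ 1/(2*π) := by positivity
  rw [Real.mul_rpow hc0 (hnn _)] at Rf Rg
  rw [Real.mul_rpow hc0 hCpos.le]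
  have hc1 : 0 ≤ (1/(2*π))^(2/p) := by positivity
  have := mul_le_mul_of_nonneg_left M (mul_nonneg hnu hc1)
  linarith

/-- regularisation -/
noncomputable def regW (ε : ℝ) (v : ℝ → ℂ) (s : ℝ) : ℂ :=
  ((‖v s‖^2 / (‖v s‖^2 + ε) : ℝ)) • v s

noncomputable def regD (ε : ℝ) (v : ℝ → ℂ) (s : ℝ) : ℂ :=
  ((‖v s‖^2 / (‖v s‖^2 + ε) : ℝ)) • deriv v s
    + ((ε * (2 * inner ℝ (v s) (deriv v s)) / (‖v s‖^2 + ε)^2 : ℝ)) • v s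

lemma regW_hasDeriv (ε : ℝ) (hε : 0 < ε) (v : ℝ → ℂ) (hv : Differentiable ℝ v) (s : ℝ) :
    HasDerivAt (regW ε v) (regD ε v s) s := by
  have e := (hv s).hasDerivAt.norm_sq
  have hne : ‖v s‖^2 + ε ≠ 0 := by positivity
  have e2 := (e.div (e.add_const ε) hne).smul (hv s).hasDerivAt
  refine e2.congr_deriv ?_
  unfold regD
  congr 2
  ring

lemma regW_norm_le (ε : ℝ) (hε : 0 < ε) (v : ℝ → ℂ) (s : ℝ) : ‖regW ε v s‖ ≤ ‖v s‖ := by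
  unfold regW
  rw [norm_smul, Real.norm_eq_abs, abs_of_nonneg (by positivity)]
  have : ‖v s‖^2 / (‖v s‖^2 + ε) ≤ 1 := by
    rw [div_le_one (by positivity)]; linarith
  nlinarith [norm_nonneg (v s)]

lemma regD_norm_le (ε : ℝ) (hε : 0 < ε) (v : ℝ → ℂ) (s : ℝ) :
    ‖regD ε v s‖ ≤ 2 * ‖deriv v s‖ := by
  unfold regD
  refine (norm_add_le _ _).trans ?_
  rw [norm_smul, norm_smul, Real.norm_eq_abs, Real.norm_eq_abs, abs_of_nonneg (by positivity)]
  have h1 : ‖v s‖^2 / (‖v s‖^2 + ε) * ‖deriv v s‖ ≤ 1 * ‖deriv v s‖ := by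
    gcongr
    rw [div_le_one (by positivity)]; linarith
  have h2 : |ε * (2 * inner ℝ (v s) (deriv v s)) / (‖v s‖^2 + ε)^2| * ‖v s‖ ≤ 1 * ‖deriv v s‖ := by
    rw [abs_div, abs_mul, abs_mul, abs_of_pos hε, abs_of_pos (by norm_num : (0:ℝ) < 2),
      abs_of_pos (by positivity : 0 < (‖v s‖^2 + ε)^2), div_mul_eq_mul_div,
      div_le_iff₀ (by positivity)]
    have := abs_real_inner_le_norm (v s) (deriv v s)
    calc ε * (2 * |inner ℝ (v s) (deriv v s)|) * ‖v s‖
        ≤ ε * (2 * (‖v s‖ * ‖deriv v s‖)) * ‖v s‖ := by gcongr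
      _ = (2 * ‖v s‖^2 * ε) * ‖deriv v s‖ := by ring
      _ ≤ (‖v s‖^2 + ε)^2 * ‖deriv v s‖ := by
          gcongr
          nlinarith [sq_nonneg (‖v s‖^2), sq_nonneg ε]
      _ = _ := by ring
  linarith

lemma aux_extend (u : ℝ → ℂ) (hu : Differentiable ℝ u) (h1 : u (-π) = 0) (h2 : u π = 0)
    (h3 : deriv u (-π) = 0) (h4 : deriv u π = 0) :
    ∃ ψ : ℝ → ℂ, Differentiable ℝ ψ ∧ Function.Periodic ψ (2*π) ∧
      ∀ s ∈ Set.Ioo (-π) π, ψ s = u s := by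
  have hpi := Real.pi_pos
  have hp2 : 0 < 2 * π := by positivity
  let u0 : ℝ → ℂ := fun s => if s ∈ Set.Icc (-π) π then u s else 0
  have hu0d : Differentiable ℝ u0 := by
    intro s
    by_cases hs : s ∈ Set.Ioo (-π) π
    · refine (hu s).congr_of_eventuallyEq ?_
      filter_upwards [isOpen_Ioo.mem_nhds hs] with t ht
      simp only [u0, if_pos (Set.Ioo_subset_Icc_self ht)]
    · by_cases hs' : s ∈ Set.Icc (-π) π
      · have hz : u s = 0 ∧ deriv u s = 0 := by
          have : s = -π ∨ s = π := by
            by_contra! h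
            exact hs ⟨lt_of_le_of_ne hs'.1 (Ne.symm h.1), lt_of_le_of_ne hs'.2 h.2⟩
          rcases this with rfl | rfl
          · exact ⟨h1, h3⟩
          · exact ⟨h2, h4⟩
        have hd := (hu s).hasDerivAt
        rw [hz.2] at hd
        have : HasDerivAt u0 0 s := by
          rw [hasDerivAt_iff_isLittleO] at hd ⊢
          refine Asymptotics.IsBigO.trans_isLittleO ?_ hd
          refine Asymptotics.IsBigO.of_bound 1 (Filter.Eventually.of_forall fun t => ?_)
          have : u0 s = 0 := by simp [u0, hz.1]
          rw [this, hz.1]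
          simp only [smul_zero, sub_zero, one_mul, u0]
          split_ifs <;> simp
        exact this.differentiableAt
      · refine (differentiableAt_const (0:ℂ)).congr_of_eventuallyEq ?_
        filter_upwards [isClosed_Icc.isOpen_compl.mem_nhds hs'] with t ht
        simp only [u0, if_neg ht]
  have hu0z : ∀ s, s ∉ Set.Ioo (-π) π → u0 s = 0 := by
    intro s hs
    simp only [u0]
    split_ifs with h
    · have : s = -π ∨ s = π := by
        by_contra! h'
        exact hs ⟨lt_of_le_of_ne h.1 (Ne.symm h'.1), lt_of_le_of_ne h.2 h'.2⟩
      rcases this with rfl | rfl <;> assumption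
    · rfl
  let ψ : ℝ → ℂ := fun s => u0 (toIcoMod hp2 (-π) s)
  have hper : Function.Periodic ψ (2*π) := fun s => by simp only [ψ, toIcoMod_add_right]
  have hIco : ∀ t ∈ Set.Ico (-π) π, ψ t = u0 t := by
    intro t ht
    simp only [ψ]
    rw [(toIcoMod_eq_self hp2).2]
    exact ⟨ht.1, by linarith [ht.2]⟩
  have hloc : ∀ t ∈ Set.Ioo (-(3*π)) π, ψ t = u0 t + u0 (t + 2*π) := by
    intro t ht
    by_cases h : -π ≤ t
    · rw [hIco t ⟨h, ht.2⟩, hu0z (t+2*π) (fun h' => by linarith [h'.2]), add_zero]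
    · push Not at h
      rw [← hper t, hIco (t+2*π) ⟨by linarith [ht.1], by linarith⟩,
        hu0z t (fun h' => by linarith [h'.1]), zero_add]
  refine ⟨ψ, ?_, hper, ?_⟩
  · intro s
    set m := toIcoDiv hp2 (-π) s
    have hm : s - m • (2*π) ∈ Set.Ico (-π) (-π + 2*π) := toIcoMod_mem_Ico hp2 (-π) s
    have hD : DifferentiableAt ℝ (fun t => u0 (t - m • (2*π)) + u0 (t - m • (2*π) + 2*π)) s := by
      fun_prop
    refine hD.congr_of_eventuallyEq ?_
    have hopen : IsOpen ((fun t : ℝ => t - m • (2*π)) ⁻¹' Set.Ioo (-(3*π)) π) :=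
      isOpen_Ioo.preimage (by fun_prop)
    filter_upwards [hopen.mem_nhds (by
      constructor
      · linarith [hm.1]
      · linarith [hm.2])] with t ht
    rw [← hloc _ ht]
    exact (hper.sub_zsmul_eq m).symm
  · intro s hs
    rw [hIco s ⟨hs.1.le, hs.2⟩]
    simp only [u0, if_pos (Set.Ioo_subset_Icc_self hs)]

lemma aux_dir_to_mag (p α : ℝ) (w : ℝ → ℂ) (hw : w ∈ dirAdm)
    (h3 : deriv w (-π) = 0) (h4 : deriv w π = 0) :
    ∃ ψ ∈ magAdm (1/2), magQuot (1/2) p α ψ = dirQuot p α w := by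
  obtain ⟨hc, hd, hi, h1, h2, s0, hs0, hne⟩ := hw
  have hpi := Real.pi_pos
  set k : ℂ := Complex.I * ((1/2 : ℝ) : ℂ) with hk
  have hexp : ∀ s : ℝ, ‖Complex.exp (-k * (s : ℂ))‖ = 1 := by
    intro s
    have : -k * (s : ℂ) = ((-(1/2 * s) : ℝ) : ℂ) * Complex.I := by rw [hk]; push_cast; ring
    rw [this, Complex.norm_exp_ofReal_mul_I]
  let u : ℝ → ℂ := fun s => Complex.exp (-k * (s : ℂ)) * w s
  have hud : ∀ s : ℝ, HasDerivAt u (Complex.exp (-k * (s : ℂ)) * (deriv w s + -k * w s)) s :=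
    fun s => aux_exp_deriv w s (-k) _ (hd s).hasDerivAt
  obtain ⟨ψ, hψd, hψp, hψe⟩ := aux_extend u (fun s => (hud s).differentiableAt)
    (by simp [u, h1]) (by simp [u, h2]) (by rw [(hud _).deriv, h3, h1]; simp)
    (by rw [(hud _).deriv, h4, h2]; simp)
  have hn : ∀ s ∈ Set.Ioo (-π) π, ‖ψ s‖ = ‖w s‖ := fun s hs => by
    rw [hψe s hs]; simp only [u, norm_mul, hexp, one_mul]
  have hdn : ∀ s ∈ Set.Ioo (-π) π, ‖deriv ψ s + k * ψ s‖ = ‖deriv w s‖ := fun s hs => by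
    have : deriv ψ s = deriv u s := by
      apply Filter.EventuallyEq.deriv_eq
      filter_upwards [isOpen_Ioo.mem_nhds hs] with t ht using hψe t ht
    rw [this, hψe s hs, (hud s).deriv]
    simp only [u]
    rw [show Complex.exp (-k * (s : ℂ)) * (deriv w s + -k * w s) + k * (Complex.exp (-k * (s : ℂ)) * w s)
      = Complex.exp (-k * (s : ℂ)) * deriv w s by ring, norm_mul, hexp, one_mul]
  have hcongr : ∀ F G : ℝ → ℝ, (∀ s ∈ Set.Ioo (-π) π, F s = G s) →
      ∫ s in (-π)..π, F s = ∫ s in (-π)..π, G s := by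
    intro F G h
    rw [intervalIntegral.integral_of_le (by linarith), intervalIntegral.integral_of_le (by linarith),
      integral_Ioc_eq_integral_Ioo, integral_Ioc_eq_integral_Ioo]
    exact setIntegral_congr_fun measurableSet_Ioo h
  refine ⟨ψ, ⟨hψd.continuous, hψp, hψd, ?_, ?_⟩, ?_⟩
  · rw [← hk]
    rw [intervalIntegrable_iff_integrableOn_Ioo_of_le (by linarith)] at hi ⊢
    exact hi.congr_fun (fun s hs => by simp only [hdn s hs]) measurableSet_Ioo
  · intro h
    have hs : s0 ∈ Set.Ioo (-π) π := by
      refine ⟨lt_of_le_of_ne hs0.1 ?_, lt_of_le_of_ne hs0.2 ?_⟩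
      · rintro rfl; exact hne h1
      · rintro rfl; exact hne h2
    have := hn s0 hs
    rw [h] at this
    simp at this
    exact hne (norm_eq_zero.1 this.symm)
  · unfold magQuot dirQuot
    rw [← hk]
    rw [hcongr (fun s => ‖deriv ψ s + k * ψ s‖^2) (fun s => ‖deriv w s‖^2)
      (fun s hs => by simp only [hdn s hs]),
      hcongr (fun s => ‖ψ s‖^2) (fun s => ‖w s‖^2) (fun s hs => by simp only [hn s hs]),
      hcongr (fun s => ‖ψ s‖^p) (fun s => ‖w s‖^p) (fun s hs => by simp only [hn s hs])]

lemma aux_reg (p α : ℝ) (hp : 2 < p) (v : ℝ → ℂ) (hv : v ∈ dirAdm) (m : ℝ)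
    (hm : ∀ w ∈ dirAdm, deriv w (-π) = 0 → deriv w π = 0 → m ≤ dirQuot p α w) :
    m ≤ dirQuot p α v := by
  obtain ⟨hc, hd, hi, h1, h2, s0, hs0, hne⟩ := hv
  have hpi := Real.pi_pos
  let ε : ℕ → ℝ := fun n => 1 / ((n : ℝ) + 1)
  have hε : ∀ n, 0 < ε n := fun n => by positivity
  have hε0 : Filter.Tendsto ε Filter.atTop (nhds 0) := tendsto_one_div_add_atTop_nhds_zero_nat
  have hwd : ∀ n s, HasDerivAt (regW (ε n) v) (regD (ε n) v s) s := fun n s =>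
    regW_hasDeriv _ (hε n) v hd s
  have hwdd : ∀ n, Differentiable ℝ (regW (ε n) v) := fun n s => (hwd n s).differentiableAt
  have hde : ∀ n s, deriv (regW (ε n) v) s = regD (ε n) v s := fun n s => (hwd n s).deriv
  have hbd : IntervalIntegrable (fun s => 4 * ‖deriv v s‖^2) volume (-π) π := hi.const_mul 4
  have hbound : ∀ n s, ‖‖deriv (regW (ε n) v) s‖^2‖ ≤ 4 * ‖deriv v s‖^2 := by
    intro n s
    rw [hde, Real.norm_eq_abs, abs_of_nonneg (by positivity)]
    have := regD_norm_le (ε n) (hε n) v s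
    nlinarith [norm_nonneg (regD (ε n) v s)]
  have hmeas : ∀ n, AEStronglyMeasurable (fun s => ‖deriv (regW (ε n) v) s‖^2)
      (volume.restrict (Set.uIoc (-π) π)) := fun n =>
    ((measurable_deriv _).norm.pow_const 2).aestronglyMeasurable
  have hadm : ∀ n, regW (ε n) v ∈ dirAdm := by
    intro n
    refine ⟨(hwdd n).continuous, hwdd n, ?_, by simp [regW, h1], by simp [regW, h2], s0, hs0, ?_⟩
    · refine hbd.mono_fun (hmeas n) (Filter.Eventually.of_forall fun s => ?_)
      refine (hbound n s).trans (le_abs_self _)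
    · have := hε n
      have h' : 0 < ‖v s0‖ := norm_pos_iff.2 hne
      have : (‖v s0‖^2 / (‖v s0‖^2 + ε n) : ℝ) ≠ 0 := by positivity
      exact smul_ne_zero this hne
  have hq : ∀ n, m ≤ dirQuot p α (regW (ε n) v) := fun n => by
    apply hm _ (hadm n)
    · rw [hde]; simp [regD, h1]
    · rw [hde]; simp [regD, h2]
  -- pointwise limits
  have hr : ∀ s, v s ≠ 0 → Filter.Tendsto (fun n => ‖v s‖^2 / (‖v s‖^2 + ε n)) Filter.atTop (nhds 1) := by
    intro s hs
    have h' : ‖v s‖^2 ≠ 0 := by simpa using hs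
    have := (tendsto_const_nhds (x := ‖v s‖^2)).div ((tendsto_const_nhds (x := ‖v s‖^2)).add hε0)
      (by simpa using hs)
    rw [add_zero, div_self h'] at this
    exact this
  have hWl : ∀ s, Filter.Tendsto (fun n => regW (ε n) v s) Filter.atTop (nhds (v s)) := by
    intro s
    by_cases hs : v s = 0
    · simp [regW, hs]
    · simpa [regW] using (hr s hs).smul_const (v s)
  let L : ℝ → ℝ := fun s => if v s = 0 then 0 else ‖deriv v s‖^2
  have hDl : ∀ s, Filter.Tendsto (fun n => ‖deriv (regW (ε n) v) s‖^2) Filter.atTop (nhds (L s)) := by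
    intro s
    simp only [hde, L]
    split_ifs with hs
    · simp [regD, hs]
    · have h' : ‖v s‖^2 ≠ 0 := by simpa using hs
      have e1 := (hr s hs).smul_const (deriv v s)
      have e2 : Filter.Tendsto (fun n => ε n * (2 * inner ℝ (v s) (deriv v s)) / (‖v s‖^2 + ε n)^2)
          Filter.atTop (nhds 0) := by
        have := (hε0.mul_const (2 * inner ℝ (v s) (deriv v s))).div
          (((tendsto_const_nhds (x := ‖v s‖^2)).add hε0).pow 2) (by simpa using hs)
        rw [zero_mul, zero_div] at this
        exact this
      have := ((e1.add (e2.smul_const (v s))).norm.pow 2)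
      simpa [regD] using this
  have T1 : Filter.Tendsto (fun n => ∫ s in (-π)..π, ‖deriv (regW (ε n) v) s‖^2) Filter.atTop
      (nhds (∫ s in (-π)..π, L s)) :=
    intervalIntegral.tendsto_integral_filter_of_dominated_convergence _
      (Filter.Eventually.of_forall hmeas)
      (Filter.Eventually.of_forall fun n => Filter.Eventually.of_forall fun s _ => hbound n s) hbd
      (Filter.Eventually.of_forall fun s _ => hDl s)
  have TT : ∀ q : ℝ, 0 < q → Filter.Tendsto (fun n => ∫ s in (-π)..π, ‖regW (ε n) v s‖^q) Filter.atTop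
      (nhds (∫ s in (-π)..π, ‖v s‖^q)) := by
    intro q hq
    have hcq : ∀ w : ℝ → ℂ, Continuous w → Continuous fun s => ‖w s‖^q := fun w hw =>
      hw.norm.rpow_const (fun s => Or.inr hq.le)
    refine intervalIntegral.tendsto_integral_filter_of_dominated_convergence (fun s => ‖v s‖^q)
      (Filter.Eventually.of_forall fun n => (hcq _ (hwdd n).continuous).aestronglyMeasurable)
      (Filter.Eventually.of_forall fun n => Filter.Eventually.of_forall fun s _ => ?_)
      ((hcq v hc).intervalIntegrable _ _)
      (Filter.Eventually.of_forall fun s _ => (hWl s).norm.rpow_const (Or.inr hq.le))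
    rw [Real.norm_eq_abs, abs_of_nonneg (by positivity)]
    exact Real.rpow_le_rpow (norm_nonneg _) (regW_norm_le _ (hε n) v s) hq.le
  have T2 := TT 2 (by norm_num)
  simp only [Real.rpow_two] at T2
  have T3 := TT p (by linarith)
  have hpos : 0 < ∫ s in (-π)..π, ‖v s‖ ^ p := by
    have hcont : Continuous fun s => ‖v s‖^p :=
      hc.norm.rpow_const (fun s => Or.inr (by linarith))
    apply intervalIntegral.integral_pos (by linarith) hcont.continuousOn (fun s _ => by positivity)
    exact ⟨s0, hs0, Real.rpow_pos_of_pos (norm_pos_iff.2 hne) _⟩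
  have hden : 0 < ((1 / (2 * π)) * ∫ s in (-π)..π, ‖v s‖ ^ p) ^ (2 / p) := by positivity
  have TQ := ((T1.const_mul (1/(2*π))).add ((T2.const_mul (1/(2*π))).const_mul α)).div
    ((T3.const_mul (1/(2*π))).rpow_const (p := 2/p) (Or.inr (by positivity))) hden.ne'
  have hmle := ge_of_tendsto' TQ hq
  refine hmle.trans ?_
  unfold dirQuot
  have hLle : ∀ s, L s ≤ ‖deriv v s‖^2 := fun s => by
    simp only [L]; split_ifs
    · positivity
    · rfl
  have hL0 : ∀ s, 0 ≤ L s := fun s => by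
    simp only [L]; split_ifs
    · rfl
    · positivity
  have hLi : IntervalIntegrable L volume (-π) π := by
    refine hi.mono_fun ?_ (Filter.Eventually.of_forall fun s => ?_)
    · exact (Measurable.ite (hc.measurable (measurableSet_singleton 0)) measurable_const
        ((measurable_deriv v).norm.pow_const 2)).aestronglyMeasurable
    · change ‖L s‖ ≤ _
      rw [Real.norm_eq_abs, abs_of_nonneg (hL0 s)]
      exact (hLle s).trans (le_abs_self _)
  have := intervalIntegral.integral_mono_on (by linarith) hLi hi (fun s _ => hLle s)
  gcongr

/-- half flux equals Dirichlet problem: for `p > 2` and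
`α > -1/4`, `μ_{1/2,p}(α) = ν_p(α)`. -/
theorem mu_half_eq_nu (p α : ℝ) (hp : 2 < p) (hα : -(1 / 4 : ℝ) < α) :
    muMag (1 / 2) p α = nuDir p α := by
  have hpi := Real.pi_pos
  have hlow : ∀ b ∈ magQuot (1/2) p α '' magAdm (1/2), nuDir p α ≤ b := by
    rintro _ ⟨ψ, hψ, rfl⟩
    exact aux_mag p α hp hα ψ hψ
  apply le_antisymm
  · apply le_csInf
    · refine ⟨_, fun s : ℝ => ((Real.sin s : ℝ) : ℂ), ?_, rfl⟩
      have hd : ∀ s : ℝ, HasDerivAt (fun s : ℝ => ((Real.sin s : ℝ) : ℂ)) ((Real.cos s : ℝ) : ℂ) s :=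
        fun s => (Real.hasDerivAt_sin s).ofReal_comp
      have hdd : Differentiable ℝ (fun s : ℝ => ((Real.sin s : ℝ) : ℂ)) :=
        fun s => (hd s).differentiableAt
      refine ⟨hdd.continuous, hdd, ?_, by simp, by simp, π/2, ⟨by linarith, by linarith⟩, by simp⟩
      simp only [(hd _).deriv]
      exact Continuous.intervalIntegrable (by fun_prop) _ _
    · rintro _ ⟨v, hv, rfl⟩
      apply aux_reg p α hp v hv
      intro w hw h3 h4
      obtain ⟨ψ, hψ, he⟩ := aux_dir_to_mag p α w hw h3 h4
      rw [← he]
      exact csInf_le ⟨_, hlow⟩ ⟨ψ, hψ, rfl⟩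
  · refine le_csInf ⟨_, fun _ => 1, ?_, rfl⟩ hlow
    refine ⟨continuous_const, fun _ => rfl, differentiable_const _, ?_, ?_⟩
    · simp only [deriv_const]
      exact Continuous.intervalIntegrable (by fun_prop) _ _
    · intro h
      have := congrFun h 0
      simp at this
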